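/- arXiv:2202.08070 — 3 statements merged into one kernel-verified Lean document; each statement's English description precedes it below -/
import Mathlib

section
/- From logarithmic covering bounds to Rademacher complexity: Let Z be a set, n a positive integer, X = (z_1,…,z_n) ∈ Z^n, and let F be a class of functions Z → [0,1] containing the zero function. Suppose there are reals W_1,…,W_p > 0 and nonnegative integers A_1,…,A_p such that for every ε > 0, log 𝒩(F, ε, ‖·‖_X) ≤ ∑_{i=1}^p 2 W_i · log(1 + A_i · ⌈n/ε²⌉). Then ℛ_X(F) ≤ (12/√n) · √( ∑_{i=1}^p 2 W_i ( log(1 + A_i) + ψ(A_i) ) ), where ψ(0) = 0 and ψ(A) = (∑_{m=1}^∞ m^{−3/2})^{1/3} · (∑_{m=1}^∞ (m + 1/A)^{−3/2})^{2/3} for integers A ≥ 1. -/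
open scoped BigOperators

noncomputable section

/-- The data-dependent `l₂` norm `‖f‖_X = sqrt (∑ i, ‖f (X i)‖²)`. -/
def dataNorm {ι E : Type*} [NormedAddCommGroup E] {n : ℕ} (X : Fin n → ι) (f : ι → E) : ℝ :=
  Real.sqrt (∑ i, ‖f (X i)‖ ^ 2)

/-- The (internal) covering number of a class `G` of functions at radius `ε` with respect to the
data-dependent norm `‖·‖_X`: the minimal cardinality (in `ℕ∞`) of a subset `U ⊆ G` such that
every `g ∈ G` is within distance `ε` of some `u ∈ U`. -/
def coveringNumber {ι E : Type*} [NormedAddCommGroup E] {n : ℕ}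
    (G : Set (ι → E)) (ε : ℝ) (X : Fin n → ι) : ℕ∞ :=
  sInf {N : ℕ∞ | ∃ U : Set (ι → E), U ⊆ G ∧
    (∀ g ∈ G, ∃ u ∈ U, dataNorm X (fun t => g t - u t) ≤ ε) ∧ N = U.encard}

end
/-- The empirical Rademacher complexity of a class `F` of real-valued functions with respect to
the sample `X`: `E_σ [ sup_{f ∈ F} (1/n) ∑ i, σ_i f (X i) ]`, the expectation taken over
uniform i.i.d. signs `σ ∈ {±1}ⁿ`. -/
noncomputable def empRademacher {Z : Type*} {n : ℕ} (F : Set (Z → ℝ)) (X : Fin n → Z) : ℝ :=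
  (∑ σ : Fin n → Bool,
      sSup ((fun f : Z → ℝ => (1 / (n : ℝ)) * ∑ i, (if σ i then (1 : ℝ) else -1) * f (X i)) ''
        F)) / 2 ^ n

/-- The function `ψ`: `ψ(0) = 0` and, for `A ≥ 1`,
`ψ(A) = ζ(3/2, 1)^{1/3} · ζ(3/2, 1 + 1/A)^{2/3}` (Hurwitz zeta values written as series). -/
noncomputable def psiAux (A : ℕ) : ℝ :=
  if A = 0 then 0
  else
    (∑' m : ℕ, ((m : ℝ) + 1) ^ (-(3 / 2) : ℝ)) ^ ((1 : ℝ) / 3) *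
      (∑' m : ℕ, (((m : ℝ) + 1) + 1 / (A : ℝ)) ^ (-(3 / 2) : ℝ)) ^ ((2 : ℝ) / 3)

/-- The signed sum `∑ i, σ i * v i` of a vector `v` along the sign pattern `σ`. -/
noncomputable def signDot {n : ℕ} (σ : Fin n → Bool) (v : EuclideanSpace ℝ (Fin n)) : ℝ :=
  ∑ i, (if σ i then (1 : ℝ) else -1) * v i

lemma signDot_add {n : ℕ} (σ : Fin n → Bool) (v w : EuclideanSpace ℝ (Fin n)) :
    signDot σ (v + w) = signDot σ v + signDot σ w := by
  simp [signDot, mul_add, Finset.sum_add_distrib]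

lemma signDot_le {n : ℕ} (σ : Fin n → Bool) (v : EuclideanSpace ℝ (Fin n)) :
    signDot σ v ≤ √n * ‖v‖ := by
  have h := Real.sum_mul_le_sqrt_mul_sqrt Finset.univ
    (fun i => if σ i then (1 : ℝ) else -1) (fun i => v i)
  have hs : ∀ i, (if σ i then (1 : ℝ) else -1) ^ 2 = 1 := fun i => by split_ifs <;> norm_num
  simpa [signDot, hs, EuclideanSpace.norm_eq] using h

/-- The moment generating function of a Rademacher sum is sub-Gaussian. -/
lemma sum_exp_signDot_le {n : ℕ} (t : ℝ) (v : EuclideanSpace ℝ (Fin n)) :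
    ∑ σ : Fin n → Bool, Real.exp (t * signDot σ v) ≤
      2 ^ n * Real.exp (t ^ 2 * ‖v‖ ^ 2 / 2) := by
  have hprod : ∑ σ : Fin n → Bool, Real.exp (t * signDot σ v) =
      ∏ i, ∑ b : Bool, Real.exp (t * ((if b then (1 : ℝ) else -1) * v i)) := by
    rw [Finset.prod_univ_sum, Fintype.piFinset_univ]
    refine Finset.sum_congr rfl fun σ _ => ?_
    rw [← Real.exp_sum, signDot, Finset.mul_sum]
  have hterm : ∀ i, ∑ b : Bool, Real.exp (t * ((if b then (1 : ℝ) else -1) * v i)) ≤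
      2 * Real.exp (t ^ 2 * v i ^ 2 / 2) := fun i => by
    have h := Real.cosh_le_exp_half_sq (t * v i)
    rw [Real.cosh_eq, mul_pow] at h
    simp only [Fintype.sum_bool, if_true, Bool.false_eq_true, if_false, one_mul, neg_one_mul,
      mul_neg]
    linarith
  calc ∑ σ : Fin n → Bool, Real.exp (t * signDot σ v)
      ≤ ∏ i, 2 * Real.exp (t ^ 2 * v i ^ 2 / 2) := by
        rw [hprod]
        exact Finset.prod_le_prod (fun i _ => by positivity) fun i _ => hterm i
    _ = 2 ^ n * Real.exp (t ^ 2 * ‖v‖ ^ 2 / 2) := by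
        rw [Finset.prod_mul_distrib, ← Real.exp_sum, EuclideanSpace.real_norm_sq_eq,
          Finset.mul_sum, Finset.sum_div]
        simp

/-- **Massart's lemma**, for a selection `M` of values of the Rademacher sums over a finite
set. -/
lemma massart_finite {n : ℕ} (S : Finset (EuclideanSpace ℝ (Fin n))) {r L : ℝ} (hr : 0 ≤ r)
    (hS : ∀ v ∈ S, ‖v‖ ≤ r) (hL : Real.log S.card ≤ L) (M : (Fin n → Bool) → ℝ)
    (hM : ∀ σ, ∃ v ∈ S, M σ = signDot σ v) :
    (∑ σ, M σ) / 2 ^ n ≤ r * √(2 * L) := by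
  set m := (∑ σ, M σ) / 2 ^ n with hm
  have hcard : 0 < S.card := by
    obtain ⟨v, hv, -⟩ := hM fun _ => true
    exact Finset.card_pos.2 ⟨v, hv⟩
  have hL0 : 0 ≤ L := (Real.log_natCast_nonneg _).trans hL
  have key : ∀ t : ℝ, t * m ≤ L + t ^ 2 * r ^ 2 / 2 := fun t => by
    have hjensen : Real.exp (t * m) ≤ ∑ σ, (1 / 2 ^ n : ℝ) * Real.exp (t * M σ) := by
      have h := convexOn_exp.map_sum_le (t := (Finset.univ : Finset (Fin n → Bool)))
        (w := fun _ => (1 / 2 ^ n : ℝ)) (p := fun σ => t * M σ) (fun _ _ => by positivity)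
        (by simp) (fun _ _ => Set.mem_univ _)
      simp only [smul_eq_mul] at h
      rwa [← Finset.mul_sum, ← Finset.mul_sum, mul_left_comm, one_div_mul_eq_div, ← hm] at h
    have hsum : ∑ σ, Real.exp (t * M σ) ≤
        2 ^ n * (S.card * Real.exp (t ^ 2 * r ^ 2 / 2)) := by
      calc ∑ σ, Real.exp (t * M σ)
          ≤ ∑ σ : Fin n → Bool, ∑ v ∈ S, Real.exp (t * signDot σ v) := by
            refine Finset.sum_le_sum fun σ _ => ?_
            obtain ⟨v, hv, h⟩ := hM σ
            rw [h]
            exact Finset.single_le_sum (f := fun v => Real.exp (t * signDot σ v))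
              (fun _ _ => (Real.exp_pos _).le) hv
        _ = ∑ v ∈ S, ∑ σ : Fin n → Bool, Real.exp (t * signDot σ v) := Finset.sum_comm
        _ ≤ ∑ v ∈ S, 2 ^ n * Real.exp (t ^ 2 * r ^ 2 / 2) := by
            refine Finset.sum_le_sum fun v hv => (sum_exp_signDot_le t v).trans ?_
            have := hS v hv
            gcongr
        _ = 2 ^ n * (S.card * Real.exp (t ^ 2 * r ^ 2 / 2)) := by
            rw [Finset.sum_const, nsmul_eq_mul]; ring
    have hexp : Real.exp (t * m) ≤ Real.exp (L + t ^ 2 * r ^ 2 / 2) := by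
      calc Real.exp (t * m) ≤ S.card * Real.exp (t ^ 2 * r ^ 2 / 2) := by
            refine hjensen.trans ?_
            rw [← Finset.mul_sum, one_div_mul_eq_div, div_le_iff₀' (by positivity)]
            exact hsum
        _ ≤ Real.exp L * Real.exp (t ^ 2 * r ^ 2 / 2) := by
            gcongr
            exact (Real.log_le_iff_le_exp (by exact_mod_cast hcard)).1 hL
        _ = _ := (Real.exp_add _ _).symm
    exact Real.exp_le_exp.1 hexp
  by_contra! hlt
  have hpos : 0 < m := lt_of_le_of_lt (by positivity) hlt
  have hsq : r ^ 2 * (2 * L) < m ^ 2 := by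
    have h := pow_lt_pow_left₀ hlt (by positivity) two_ne_zero
    rwa [mul_pow, Real.sq_sqrt (by positivity)] at h
  rcases hr.eq_or_lt with rfl | hr
  · have h := key ((L + 1) / m)
    rw [div_mul_cancel₀ _ hpos.ne'] at h
    norm_num at h
  · have h := key (m / r ^ 2)
    have h1 : m / r ^ 2 * m = m ^ 2 / r ^ 2 := by ring
    have h2 : (m / r ^ 2) ^ 2 * r ^ 2 / 2 = m ^ 2 / r ^ 2 / 2 := by field_simp
    have h3 : 2 * L < m ^ 2 / r ^ 2 := by
      rw [lt_div_iff₀ (by positivity)]; linarith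
    rw [h1, h2] at h
    linarith

/-- **Dudley's chaining bound** along a dyadic sequence of finite covers starting at `{0}`. -/
lemma exists_chaining_bound {n : ℕ} (T : Set (EuclideanSpace ℝ (Fin n))) (hT : T.Nonempty)
    {R : ℝ} (hR : 0 ≤ R) (L : ℕ → ℝ) (hLmono : Monotone L)
    (U : ℕ → Finset (EuclideanSpace ℝ (Fin n))) (hU0 : U 0 = {0})
    (hU : ∀ j, ∀ v ∈ T, ∃ u ∈ U j, ‖v - u‖ ≤ R / 2 ^ j)
    (hcard : ∀ j, Real.log (U j).card ≤ L j) (N : ℕ) :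
    ∃ B : (Fin n → Bool) → ℝ, (∀ σ, ∀ v ∈ T, signDot σ v ≤ B σ) ∧
      (∑ σ, B σ) / 2 ^ n ≤
        √n * (R / 2 ^ N) + 6 * R * ∑ j ∈ Finset.range N, (1 / 2 ^ (j + 1)) * √(L (j + 1)) := by
  classical
  choose! π hπU hπ using hU
  let S : ℕ → Finset (EuclideanSpace ℝ (Fin n)) := fun j =>
    (Finset.image₂ (fun u w => u - w) (U (j + 1)) (U j)).filter
      fun v => ‖v‖ ≤ 3 * (R / 2 ^ (j + 1))
  have hmem : ∀ j, ∀ v ∈ T, π (j + 1) v - π j v ∈ S j := fun j v hv => by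
    refine Finset.mem_filter.2
      ⟨Finset.mem_image₂_of_mem (hπU _ _ hv) (hπU _ _ hv), ?_⟩
    have h1 := hπ (j + 1) v hv
    have h2 := hπ j v hv
    have h3 := norm_sub_le (v - π j v) (v - π (j + 1) v)
    rw [sub_sub_sub_cancel_left] at h3
    have h4 : R / 2 ^ j = 2 * (R / 2 ^ (j + 1)) := by rw [pow_succ]; field_simp
    linarith
  have hSne : ∀ j, (S j).Nonempty := fun j => hT.elim fun v hv => ⟨_, hmem j v hv⟩
  choose w hwS hw using fun j σ => Finset.exists_max_image (S j) (signDot σ) (hSne j)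
  have hlevel : ∀ j, (∑ σ, signDot σ (w j σ)) / 2 ^ n ≤
      6 * R * ((1 / 2 ^ (j + 1)) * √(L (j + 1))) := fun j => by
    have hlog : Real.log (S j).card ≤ 2 * L (j + 1) := by
      have hle : (S j).card ≤ (U (j + 1)).card * (U j).card :=
        (Finset.card_filter_le _ _).trans (Finset.card_image₂_le _ _ _)
      have hpos : 0 < (S j).card := Finset.card_pos.2 (hSne j)
      have hmul : (0 : ℕ) < (U (j + 1)).card * (U j).card := hpos.trans_le hle
      calc Real.log (S j).card ≤ Real.log ((U (j + 1)).card * (U j).card : ℝ) :=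
            Real.log_le_log (by exact_mod_cast hpos) (by exact_mod_cast hle)
        _ = Real.log (U (j + 1)).card + Real.log (U j).card :=
            Real.log_mul (by exact_mod_cast (pos_of_mul_pos_left hmul (Nat.zero_le _)).ne')
              (by exact_mod_cast (pos_of_mul_pos_right hmul (Nat.zero_le _)).ne')
        _ ≤ 2 * L (j + 1) := by
            linarith [hcard (j + 1), hcard j, hLmono (Nat.le_succ j)]
    have h := massart_finite (S j) (r := 3 * (R / 2 ^ (j + 1))) (by positivity)
      (fun v hv => (Finset.mem_filter.1 hv).2) hlog (fun σ => signDot σ (w j σ))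
      fun σ => ⟨_, hwS j σ, rfl⟩
    have hsqrt : √(2 * (2 * L (j + 1))) = 2 * √(L (j + 1)) := by
      rw [← mul_assoc, Real.sqrt_mul (by norm_num)]
      congr 1
      rw [Real.sqrt_mul_self (by norm_num)]
    rw [hsqrt] at h
    refine h.trans_eq ?_
    ring
  refine ⟨fun σ => √n * (R / 2 ^ N) + ∑ j ∈ Finset.range N, signDot σ (w j σ), ?_, ?_⟩
  · intro σ v hv
    have hzero : π 0 v = 0 := by simpa [hU0] using hπU 0 v hv
    have htel : ∀ k, signDot σ (π k v) ≤ ∑ j ∈ Finset.range k, signDot σ (w j σ) := by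
      intro k
      induction k with
      | zero => simp [hzero, signDot]
      | succ k ih =>
        rw [Finset.sum_range_succ, ← add_sub_cancel (π k v) (π (k + 1) v), signDot_add]
        exact add_le_add ih (hw k σ _ (hmem k v hv))
    calc signDot σ v = signDot σ (v - π N v) + signDot σ (π N v) := by
          rw [← signDot_add, sub_add_cancel]
      _ ≤ _ := by
          refine add_le_add ((signDot_le σ _).trans ?_) (htel N)
          gcongr
          exact hπ N v hv
  · rw [Finset.sum_add_distrib, add_div, Finset.sum_comm (s := Finset.univ),
      Finset.sum_div (s := Finset.range N), Finset.mul_sum]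
    refine add_le_add (le_of_eq ?_) (Finset.sum_le_sum fun j _ => ?_)
    · simp only [Finset.sum_const, Finset.card_univ, Fintype.card_pi_const, Fintype.card_bool,
        nsmul_eq_mul, Nat.cast_pow, Nat.cast_ofNat]
      exact mul_div_cancel_left₀ _ (by positivity)
    · exact hlevel j

lemma exists_finset_cover {ι E : Type*} [NormedAddCommGroup E] {n : ℕ} {G : Set (ι → E)}
    {ε : ℝ} (hε : 0 ≤ ε) {X : Fin n → ι} (h : coveringNumber G ε X ≠ ⊤) :
    ∃ U : Finset (ι → E), (∀ g ∈ G, ∃ u ∈ U, dataNorm X (fun t => g t - u t) ≤ ε) ∧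
      U.card = (coveringNumber G ε X).toNat := by
  obtain ⟨U, -, hcov, hU⟩ := csInf_mem (s := {N : ℕ∞ | ∃ U : Set (ι → E), U ⊆ G ∧
    (∀ g ∈ G, ∃ u ∈ U, dataNorm X (fun t => g t - u t) ≤ ε) ∧ N = U.encard})
    ⟨_, G, subset_rfl, fun g hg => ⟨g, hg, by simpa [dataNorm] using hε⟩, rfl⟩
  change coveringNumber G ε X = _ at hU
  have hfin : U.Finite := Set.encard_ne_top_iff.1 (hU ▸ h)
  refine ⟨hfin.toFinset, fun g hg => ?_, ?_⟩
  · obtain ⟨u, hu, hgu⟩ := hcov g hg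
    exact ⟨u, hfin.mem_toFinset.2 hu, hgu⟩
  · rw [hU, hfin.encard_eq_coe_toFinset_card, ENat.toNat_natCast]

lemma quarter_le_psiAux {A : ℕ} (hA : A ≠ 0) : 1 / 4 ≤ psiAux A := by
  have hA1 : (1 : ℝ) ≤ A := by exact_mod_cast Nat.one_le_iff_ne_zero.2 hA
  have hinv : 1 / (A : ℝ) ≤ 1 := (div_le_one (by linarith)).2 hA1
  have hinv0 : 0 ≤ 1 / (A : ℝ) := by positivity
  have hsum : Summable fun m : ℕ => ((m : ℝ) + 1) ^ (-(3 / 2) : ℝ) := by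
    have h := (summable_nat_add_iff 1).2
      (Real.summable_nat_rpow (p := (-(3 / 2) : ℝ)).2 (by norm_num))
    simpa using h
  have hsum' : Summable fun m : ℕ => (((m : ℝ) + 1) + 1 / (A : ℝ)) ^ (-(3 / 2) : ℝ) := by
    refine hsum.of_nonneg_of_le (fun m => by positivity) fun m => ?_
    exact Real.rpow_le_rpow_of_nonpos (by positivity) (by linarith) (by norm_num)
  have h1 : 1 ≤ ∑' m : ℕ, ((m : ℝ) + 1) ^ (-(3 / 2) : ℝ) := by
    simpa using hsum.le_tsum 0 fun m _ => by positivity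
  have h2 : (2 : ℝ) ^ (-(3 / 2) : ℝ) ≤
      ∑' m : ℕ, (((m : ℝ) + 1) + 1 / (A : ℝ)) ^ (-(3 / 2) : ℝ) := by
    refine le_trans ?_ (hsum'.le_tsum 0 fun m _ => by positivity)
    exact Real.rpow_le_rpow_of_nonpos (by positivity) (by push_cast; linarith) (by norm_num)
  have h3 := Real.one_le_rpow h1 (by norm_num : (0 : ℝ) ≤ 1 / 3)
  have h4 := Real.rpow_le_rpow (by positivity) h2 (by norm_num : (0 : ℝ) ≤ 2 / 3)
  rw [← Real.rpow_mul (by norm_num)] at h4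
  norm_num [Real.rpow_neg_one] at h4
  rw [psiAux, if_neg hA]
  norm_num at h3 ⊢
  nlinarith

lemma sum_range_succ_div_two_pow (N : ℕ) :
    ∑ j ∈ Finset.range N, (1 / 2 ^ (j + 1) : ℝ) * (j + 1) = 2 - (N + 2) / 2 ^ N := by
  induction N with
  | zero => norm_num
  | succ N ih =>
    rw [Finset.sum_range_succ, ih, pow_succ]
    push_cast
    field_simp
    ring

lemma sum_range_one_div_two_pow_succ_le (N : ℕ) :
    ∑ j ∈ Finset.range N, (1 / 2 ^ (j + 1) : ℝ) ≤ 1 := by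
  have h : ∑ j ∈ Finset.range N, (1 / 2 ^ (j + 1) : ℝ) = 1 - 1 / 2 ^ N := by
    induction N with
    | zero => norm_num
    | succ N ih =>
      rw [Finset.sum_range_succ, ih, pow_succ]
      field_simp
      ring
  rw [h]
  linarith [show (0 : ℝ) ≤ 1 / 2 ^ N by positivity]

lemma sum_dyadic_log_le (A N : ℕ) :
    ∑ j ∈ Finset.range N, (1 / 2 ^ (j + 1) : ℝ) * Real.log (1 + A * 4 ^ (j + 1)) ≤
      4 * (Real.log (1 + A) + psiAux A) := by
  rcases eq_or_ne A 0 with rfl | hA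
  · simp [psiAux]
  have hA1 : (1 : ℝ) ≤ A := by exact_mod_cast Nat.one_le_iff_ne_zero.2 hA
  have hlog2 : Real.log 2 ≤ Real.log (1 + A) := Real.log_le_log (by norm_num) (by linarith)
  have hlog4 : Real.log 4 = 2 * Real.log 2 := by
    rw [show (4 : ℝ) = 2 ^ 2 by norm_num, Real.log_pow]; norm_num
  have hlogpos : 0 < Real.log 2 := Real.log_pos (by norm_num)
  have hterm : ∀ j : ℕ, Real.log (1 + A * 4 ^ (j + 1)) ≤
      Real.log (1 + A) + (j + 1) * (2 * Real.log 2) := fun j => by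
    have h4 : (1 : ℝ) ≤ 4 ^ (j + 1) := one_le_pow₀ (by norm_num)
    calc Real.log (1 + A * 4 ^ (j + 1)) ≤ Real.log ((1 + A) * 4 ^ (j + 1)) :=
          Real.log_le_log (by positivity) (by linarith)
      _ = _ := by
          rw [Real.log_mul (by positivity) (by positivity), Real.log_pow, hlog4]
          push_cast
          ring
  calc ∑ j ∈ Finset.range N, (1 / 2 ^ (j + 1) : ℝ) * Real.log (1 + A * 4 ^ (j + 1))
      ≤ ∑ j ∈ Finset.range N, (1 / 2 ^ (j + 1) : ℝ) *
          (Real.log (1 + A) + (j + 1) * (2 * Real.log 2)) := by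
        gcongr with j
        exact hterm j
    _ = (∑ j ∈ Finset.range N, (1 / 2 ^ (j + 1) : ℝ)) * Real.log (1 + A) +
          (∑ j ∈ Finset.range N, (1 / 2 ^ (j + 1) : ℝ) * (j + 1)) * (2 * Real.log 2) := by
        rw [Finset.sum_mul, Finset.sum_mul, ← Finset.sum_add_distrib]
        exact Finset.sum_congr rfl fun j _ => by ring
    _ ≤ 1 * Real.log (1 + A) + 2 * (2 * Real.log 2) := by
        gcongr
        · linarith
        · exact sum_range_one_div_two_pow_succ_le N
        · rw [sum_range_succ_div_two_pow]
          linarith [show (0 : ℝ) ≤ (N + 2) / 2 ^ N by positivity]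
    _ ≤ 4 * (Real.log (1 + A) + psiAux A) := by
        linarith [quarter_le_psiAux hA, Real.log_two_lt_d9]

/-- **From logarithmic covering bounds to Rademacher complexity.** If `F` maps into `[0,1]`,
contains the zero function, and `log 𝒩(F, ε, ‖·‖_X) ≤ ∑ i, 2·W i·log(1 + A i·⌈n/ε²⌉)` for all
`ε > 0`, then `ℛ_X(F) ≤ (12/√n)·√(∑ i, 2·W i·(log(1 + A i) + ψ(A i)))`. -/
theorem rademacher_of_covering_log_form {Z : Type*} {n p : ℕ} (hn : 0 < n) (X : Fin n → Z)
    (F : Set (Z → ℝ)) (hrange : ∀ f ∈ F, ∀ z, f z ∈ Set.Icc (0 : ℝ) 1)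
    (hzero : (fun _ => (0 : ℝ)) ∈ F)
    (W : Fin p → ℝ) (hW : ∀ i, 0 < W i) (A : Fin p → ℕ)
    (hcov : ∀ ε : ℝ, 0 < ε → coveringNumber F ε X ≠ ⊤ ∧
      Real.log ((coveringNumber F ε X).toNat : ℝ) ≤
        ∑ i, 2 * W i * Real.log (1 + (A i : ℝ) * (⌈(n : ℝ) / ε ^ 2⌉₊ : ℝ))) :
    empRademacher F X ≤
      12 / Real.sqrt n *
        Real.sqrt (∑ i, 2 * W i * (Real.log (1 + (A i : ℝ)) + psiAux (A i))) := by
  have hn' : (0 : ℝ) < n := by exact_mod_cast hn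
  set C := ∑ i, 2 * W i * (Real.log (1 + (A i : ℝ)) + psiAux (A i)) with hC
  set L : ℕ → ℝ := fun j => ∑ i, 2 * W i * Real.log (1 + (A i : ℝ) * 4 ^ j) with hL
  have hLmono : Monotone L := fun j k hjk => by
    refine Finset.sum_le_sum fun i _ => ?_
    have := hW i
    gcongr
    norm_num
  have hLnonneg : ∀ j, 0 ≤ L j := fun j => Finset.sum_nonneg fun i _ => by
    have := hW i
    have := Real.log_nonneg (show (1 : ℝ) ≤ 1 + A i * 4 ^ j by
      linarith [show (0 : ℝ) ≤ A i * 4 ^ j by positivity])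
    positivity
  set toVec : (Z → ℝ) → EuclideanSpace ℝ (Fin n) := fun f => WithLp.toLp 2 fun i => f (X i)
    with htoVec
  have hnorm : ∀ f u : Z → ℝ, ‖toVec f - toVec u‖ = dataNorm X fun t => f t - u t :=
    fun f u => by simp [htoVec, EuclideanSpace.norm_eq, dataNorm]
  have hcover : ∀ j : ℕ, ∃ U : Finset (EuclideanSpace ℝ (Fin n)), (j = 0 → U = {0}) ∧
      (∀ v ∈ toVec '' F, ∃ u ∈ U, ‖v - u‖ ≤ √n / 2 ^ j) ∧ Real.log U.card ≤ L j := by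
    classical
    intro j
    rcases eq_or_ne j 0 with rfl | hj
    · refine ⟨{0}, fun _ => rfl, ?_, by simpa using hLnonneg 0⟩
      rintro _ ⟨f, hf, rfl⟩
      refine ⟨0, Finset.mem_singleton_self _, ?_⟩
      rw [sub_zero, pow_zero, div_one, EuclideanSpace.norm_eq]
      refine Real.sqrt_le_sqrt ?_
      calc ∑ i, ‖toVec f i‖ ^ 2 ≤ ∑ _i : Fin n, (1 : ℝ) := by
            refine Finset.sum_le_sum fun i _ => ?_
            obtain ⟨h0, h1⟩ := hrange f hf (X i)
            refine pow_le_one₀ (norm_nonneg _) ?_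
            simpa [htoVec, abs_of_nonneg h0] using h1
        _ = n := by simp
    · have hε : 0 < √n / 2 ^ j := by positivity
      obtain ⟨hfin, hlog⟩ := hcov _ hε
      obtain ⟨U, hU, hcard⟩ := exists_finset_cover hε.le hfin
      refine ⟨U.image toVec, fun h => absurd h hj, ?_, ?_⟩
      · rintro _ ⟨f, hf, rfl⟩
        obtain ⟨u, hu, hfu⟩ := hU f hf
        exact ⟨_, Finset.mem_image_of_mem _ hu, (hnorm f u).trans_le hfu⟩
      · have hceil : ⌈(n : ℝ) / (√n / 2 ^ j) ^ 2⌉₊ = 4 ^ j := by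
          have : (n : ℝ) / (√n / 2 ^ j) ^ 2 = ((4 ^ j : ℕ) : ℝ) := by
            rw [div_pow, Real.sq_sqrt hn'.le, ← pow_mul, mul_comm j 2, pow_mul]
            field_simp
            norm_num
          rw [this, Nat.ceil_natCast]
        rw [← hcard, hceil] at hlog
        push_cast at hlog
        refine le_trans ?_ hlog
        obtain ⟨u, hu, -⟩ := hU _ hzero
        refine Real.log_le_log ?_ (by exact_mod_cast Finset.card_image_le)
        exact_mod_cast Finset.card_pos.2 ⟨_, Finset.mem_image_of_mem toVec hu⟩
  choose U hU0 hU hUcard using hcover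
  have hdyadic : ∀ N, ∑ j ∈ Finset.range N, (1 / 2 ^ (j + 1) : ℝ) * √(L (j + 1)) ≤
      2 * √C := fun N => by
    have hsum : ∑ j ∈ Finset.range N, (1 / 2 ^ (j + 1) : ℝ) * L (j + 1) ≤ 4 * C := by
      simp only [hL, hC, Finset.mul_sum]
      rw [Finset.sum_comm]
      refine Finset.sum_le_sum fun i _ => ?_
      calc _ = 2 * W i * ∑ j ∈ Finset.range N,
              (1 / 2 ^ (j + 1) : ℝ) * Real.log (1 + A i * 4 ^ (j + 1)) := by
            rw [Finset.mul_sum]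
            exact Finset.sum_congr rfl fun j _ => by ring
        _ ≤ 2 * W i * (4 * (Real.log (1 + A i) + psiAux (A i))) :=
            mul_le_mul_of_nonneg_left (sum_dyadic_log_le _ _) (by linarith [hW i])
        _ = _ := by ring
    have hcs := Finset.sum_sq_le_sum_mul_sum_of_sq_le_mul (Finset.range N)
      (r := fun j => (1 / 2 ^ (j + 1) : ℝ) * √(L (j + 1)))
      (f := fun j => (1 / 2 ^ (j + 1) : ℝ)) (g := fun j => (1 / 2 ^ (j + 1) : ℝ) * L (j + 1))
      (fun j _ => by positivity) (fun j _ => mul_nonneg (by positivity) (hLnonneg _))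
      (fun j _ => le_of_eq (by rw [mul_pow, Real.sq_sqrt (hLnonneg _)]; ring))
    have hg : 0 ≤ ∑ j ∈ Finset.range N, (1 / 2 ^ (j + 1) : ℝ) * L (j + 1) :=
      Finset.sum_nonneg fun j _ => mul_nonneg (by positivity) (hLnonneg _)
    have hle := mul_le_mul_of_nonneg_right (sum_range_one_div_two_pow_succ_le N) hg
    calc _ ≤ √(4 * C) := Real.le_sqrt_of_sq_le (by linarith)
      _ = 2 * √C := by
        rw [show (4 : ℝ) = 2 ^ 2 by norm_num, Real.sqrt_mul (by norm_num),
          Real.sqrt_sq (by norm_num)]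
  have hbound : ∀ N : ℕ, empRademacher F X ≤ (1 / 2) ^ N + 12 / √n * √C := fun N => by
    obtain ⟨B, hB, hBsum⟩ := exists_chaining_bound (toVec '' F) ⟨_, _, hzero, rfl⟩
      (Real.sqrt_nonneg n) L hLmono U (hU0 0 rfl) hU hUcard N
    have hemp : empRademacher F X ≤ (1 / n) * ((∑ σ, B σ) / 2 ^ n) := by
      rw [empRademacher, ← mul_div_assoc, Finset.mul_sum]
      gcongr with σ
      refine csSup_le ⟨_, _, hzero, rfl⟩ ?_
      rintro _ ⟨f, hf, rfl⟩
      exact mul_le_mul_of_nonneg_left (hB σ _ ⟨f, hf, rfl⟩) (by positivity)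
    calc empRademacher F X
        ≤ (1 / n) * (√n * (√n / 2 ^ N) + 6 * √n * (2 * √C)) := by
          refine hemp.trans (mul_le_mul_of_nonneg_left (hBsum.trans ?_) (by positivity))
          gcongr
          exact hdyadic N
      _ = (1 / 2) ^ N + 12 / √n * √C := by
          have hs0 : 0 < √(n : ℝ) := by positivity
          have hs : (n : ℝ) = √n ^ 2 := (Real.sq_sqrt hn'.le).symm
          generalize √(n : ℝ) = s at hs hs0
          rw [hs, one_div_pow]
          field_simp
          ring
  have hlim : Filter.Tendsto (fun N : ℕ => (1 / 2 : ℝ) ^ N + 12 / √n * √C) Filter.atTop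
      (nhds (0 + 12 / √n * √C)) :=
    (tendsto_pow_atTop_nhds_zero_of_lt_one (by norm_num) (by norm_num)).add_const _
  rw [zero_add] at hlim
  exact ge_of_tendsto' hlim hbound
end

section
/- Integral bound via Hurwitz zeta values: For every real α > 0, ∫_0^1 log(1 + α·⌈1/s²⌉) ds ≤ log(1 + α) + ( ∑_{m=1}^∞ m^{−3/2} )^{1/3} · ( ∑_{m=1}^∞ (m + 1/α)^{−3/2} )^{2/3}. -/
open MeasureTheory

/-- Layer-cake form: a telescoping sum cut off at `⌈x⌉₊`. -/
lemma tsum_ite_lt_sub_eq (g : ℕ → ℝ) (x : ℝ) :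
    ∑' k : ℕ, (if (k : ℝ) < x then g (k + 1) - g k else 0) = g ⌈x⌉₊ - g 0 := by
  rw [tsum_eq_sum (s := Finset.range ⌈x⌉₊), ← Finset.sum_range_sub]
  · refine Finset.sum_congr rfl fun k hk => if_pos ?_
    exact Nat.lt_ceil.mp (Finset.mem_range.mp hk)
  · intro k hk
    refine if_neg fun h => hk ?_
    exact Finset.mem_range.mpr (Nat.lt_ceil.mpr h)

lemma integrable_ite_lt_one_div_sq (c y : ℝ) :
    IntegrableOn (fun s : ℝ => if y < 1 / s ^ 2 then c else 0) (Set.Ioc 0 1) := by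
  have hm : MeasurableSet {s : ℝ | y < 1 / s ^ 2} :=
    measurableSet_lt measurable_const (by fun_prop)
  exact (integrable_const c).indicator hm

lemma integral_ite_lt_one_div_sq (c : ℝ) {y : ℝ} (hy : 1 ≤ y) :
    ∫ s in Set.Ioc (0 : ℝ) 1, (if y < 1 / s ^ 2 then c else 0) = y ^ (-(1 / 2) : ℝ) * c := by
  have hm : MeasurableSet {s : ℝ | y < 1 / s ^ 2} :=
    measurableSet_lt measurable_const (by fun_prop)
  have hy0 : 0 < y := by linarith
  have hset : Set.Ioc (0 : ℝ) 1 ∩ {s : ℝ | y < 1 / s ^ 2} = Set.Ioo 0 (1 / √y) := by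
    have hiff : ∀ s : ℝ, 0 < s → (y < 1 / s ^ 2 ↔ s < 1 / √y) := fun s hs => by
      rw [lt_div_iff₀ (by positivity), lt_div_iff₀ (by positivity),
        ← sq_lt_one_iff₀ (a := s * √y) (by positivity), mul_pow, Real.sq_sqrt hy0.le, mul_comm]
    ext s
    simp only [Set.mem_inter_iff, Set.mem_Ioc, Set.mem_ofPred_eq, Set.mem_Ioo]
    constructor
    · rintro ⟨⟨h0, -⟩, h⟩
      exact ⟨h0, (hiff s h0).mp h⟩
    · rintro ⟨h0, h⟩
      refine ⟨⟨h0, h.le.trans ?_⟩, (hiff s h0).mpr h⟩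
      rw [div_le_one (by positivity)]
      exact Real.one_le_sqrt.mpr hy
  calc ∫ s in Set.Ioc (0 : ℝ) 1, (if y < 1 / s ^ 2 then c else 0)
      = ∫ s in Set.Ioc (0 : ℝ) 1, {s : ℝ | y < 1 / s ^ 2}.indicator (fun _ => c) s := rfl
    _ = y ^ (-(1 / 2) : ℝ) * c := by
      rw [setIntegral_indicator hm, hset, setIntegral_const, Real.volume_real_Ioo_of_le
        (by positivity), sub_zero, smul_eq_mul, Real.sqrt_eq_rpow, Real.rpow_neg hy0.le, one_div]

lemma summable_nat_add_one_add_rpow {b p : ℝ} (hb : 0 ≤ b) (hp : p < -1) :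
    Summable fun m : ℕ => ((m : ℝ) + 1 + b) ^ p := by
  have h := (summable_nat_add_iff 1).mpr (Real.summable_nat_rpow.mpr hp)
  refine Summable.of_nonneg_of_le (fun m => by positivity) (fun m => ?_) h
  push_cast
  exact Real.rpow_le_rpow_of_nonpos (by positivity) (by linarith) (by linarith)

/-- Hölder's inequality with exponents `3` and `3/2`. -/
lemma summable_and_tsum_rpow_mul_inv_le {b : ℝ} (hb : 0 ≤ b) :
    (Summable fun m : ℕ => ((m : ℝ) + 1) ^ (-(1 / 2) : ℝ) * ((m : ℝ) + 1 + b)⁻¹) ∧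
      ∑' m : ℕ, ((m : ℝ) + 1) ^ (-(1 / 2) : ℝ) * ((m : ℝ) + 1 + b)⁻¹ ≤
        (∑' m : ℕ, ((m : ℝ) + 1) ^ (-(3 / 2) : ℝ)) ^ ((1 : ℝ) / 3) *
          (∑' m : ℕ, (((m : ℝ) + 1) + b) ^ (-(3 / 2) : ℝ)) ^ ((2 : ℝ) / 3) := by
  have hpq : (3 : ℝ).HolderConjugate (3 / 2) :=
    Real.holderConjugate_iff.mpr ⟨by norm_num, by norm_num⟩
  have hf : ∀ m : ℕ, (((m : ℝ) + 1) ^ (-(1 / 2) : ℝ)) ^ (3 : ℝ) =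
      ((m : ℝ) + 1) ^ (-(3 / 2) : ℝ) := fun m => by
    rw [← Real.rpow_mul (by positivity)]; norm_num
  have hg : ∀ m : ℕ, (((m : ℝ) + 1 + b)⁻¹) ^ (3 / 2 : ℝ) =
      ((m : ℝ) + 1 + b) ^ (-(3 / 2) : ℝ) := fun m => by
    rw [Real.inv_rpow (by positivity), Real.rpow_neg (by positivity)]
  have hfs := summable_nat_add_one_add_rpow (b := 0) (p := -(3 / 2)) le_rfl (by norm_num)
  simp only [add_zero] at hfs
  have key := Real.summable_and_inner_le_Lp_mul_Lq_tsum_of_nonneg hpq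
    (f := fun m : ℕ => ((m : ℝ) + 1) ^ (-(1 / 2) : ℝ)) (g := fun m : ℕ => ((m : ℝ) + 1 + b)⁻¹)
    (fun m => by positivity) (fun m => by positivity) (by simpa only [hf] using hfs)
    (by simpa only [hg] using summable_nat_add_one_add_rpow hb (by norm_num))
  simp only [hf, hg] at key
  rwa [one_div_div] at key

lemma log_one_add_mul_succ_sub_le {α x : ℝ} (hα : 0 < α) (hx : 0 ≤ x) :
    Real.log (1 + α * (x + 1)) - Real.log (1 + α * x) ≤ (x + 1 / α)⁻¹ := by
  rw [← Real.log_div (by positivity) (by positivity)]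
  refine (Real.log_le_sub_one_of_pos (by positivity)).trans (le_of_eq ?_)
  field_simp
  ring

/-- **Integral bound via Hurwitz zeta values.** For every `α > 0`,
`∫_0^1 log(1 + α·⌈1/s²⌉) ds ≤ log(1+α) + ζ(3/2, 1)^{1/3} · ζ(3/2, 1 + 1/α)^{2/3}`,
the Hurwitz zeta values written as series. -/
theorem integral_log_ceil_le (α : ℝ) (hα : 0 < α) :
    ∫ s in Set.Ioc (0 : ℝ) 1, Real.log (1 + α * ((⌈1 / s ^ 2⌉ : ℤ) : ℝ)) ≤
      Real.log (1 + α) +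
        (∑' m : ℕ, ((m : ℝ) + 1) ^ (-(3 / 2) : ℝ)) ^ ((1 : ℝ) / 3) *
          (∑' m : ℕ, (((m : ℝ) + 1) + 1 / α) ^ (-(3 / 2) : ℝ)) ^ ((2 : ℝ) / 3) := by
  set g : ℕ → ℝ := fun n => Real.log (1 + α * n) with hg
  set F : ℕ → ℝ → ℝ := fun k s => if (k : ℝ) < 1 / s ^ 2 then g (k + 1) - g k else 0 with hF
  have hg_mono : ∀ k, 0 ≤ g (k + 1) - g k := fun k => by
    refine sub_nonneg.mpr (Real.log_le_log (by positivity) ?_)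
    gcongr
    simp
  have hF_nonneg : ∀ k s, 0 ≤ F k s := fun k s => by
    simp only [hF]
    split_ifs
    exacts [hg_mono k, le_rfl]
  have hF_succ : ∀ k : ℕ, ∫ s in Set.Ioc (0 : ℝ) 1, F (k + 1) s =
      ((k : ℝ) + 1) ^ (-(1 / 2) : ℝ) * (g (k + 2) - g (k + 1)) := fun k => by
    have h := integral_ite_lt_one_div_sq (g (k + 2) - g (k + 1)) (y := (k : ℝ) + 1) (by simp)
    simpa only [hF, Nat.cast_add, Nat.cast_one] using h
  have hF_le : ∀ k : ℕ, ∫ s in Set.Ioc (0 : ℝ) 1, F (k + 1) s ≤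
      ((k : ℝ) + 1) ^ (-(1 / 2) : ℝ) * ((k : ℝ) + 1 + 1 / α)⁻¹ := fun k => by
    rw [hF_succ]
    gcongr
    have h := log_one_add_mul_succ_sub_le hα (x := (k : ℝ) + 1) (by positivity)
    rw [show (k : ℝ) + 1 + 1 = k + 2 by ring] at h
    simpa only [hg, Nat.cast_add, Nat.cast_one, Nat.cast_ofNat] using h
  obtain ⟨hsum, hle⟩ := summable_and_tsum_rpow_mul_inv_le (b := 1 / α) (by positivity)
  have hF_summable : Summable fun k => ∫ s in Set.Ioc (0 : ℝ) 1, F (k + 1) s :=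
    hsum.of_nonneg_of_le (fun k => integral_nonneg (hF_nonneg _)) hF_le
  have hF_hasSum : HasSum (fun k => ∫ s in Set.Ioc (0 : ℝ) 1, F k s)
      (∫ s in Set.Ioc (0 : ℝ) 1, ∑' k, F k s) := by
    refine hasSum_integral_of_summable_integral_norm
      (fun k => integrable_ite_lt_one_div_sq _ _) ((summable_nat_add_iff 1).mp ?_)
    simpa only [Real.norm_of_nonneg (hF_nonneg _ _)] using hF_summable
  have hint : ∫ s in Set.Ioc (0 : ℝ) 1, Real.log (1 + α * ((⌈1 / s ^ 2⌉ : ℤ) : ℝ)) =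
      ∫ s in Set.Ioc (0 : ℝ) 1, ∑' k, F k s := by
    refine integral_congr_ae (Filter.Eventually.of_forall fun s => ?_)
    have hs : (0 : ℝ) ≤ 1 / s ^ 2 := by positivity
    change _ = ∑' k : ℕ, (if (k : ℝ) < 1 / s ^ 2 then g (k + 1) - g k else 0)
    rw [tsum_ite_lt_sub_eq]
    simp only [hg, natCast_ceil_eq_intCast_ceil hs]
    simp
  have hF_zero : ∫ s in Set.Ioc (0 : ℝ) 1, F 0 s = Real.log (1 + α) := by
    have h : ∀ s ∈ Set.Ioc (0 : ℝ) 1, F 0 s = Real.log (1 + α) := fun s hs => by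
      simp [hF, hg, hs.1]
    rw [setIntegral_congr_fun measurableSet_Ioc h]
    simp
  rw [hint, ← hF_hasSum.tsum_eq, hF_hasSum.summable.tsum_eq_zero_add, hF_zero]
  gcongr
  exact (hF_summable.tsum_le_tsum hF_le hsum).trans hle
end

section
/- Series representation of the ceiling-log integral: For every real α > 0, the function s ↦ log(1 + α·⌈1/s²⌉) is integrable on (0,1] and ∫_0^1 log(1 + α·⌈1/s²⌉) ds = log(1 + α) + ∑_{m=1}^∞ (1/√m) · log( 1 + 1/(1/α + m) ), where the series on the right converges. -/
open MeasureTheory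

lemma lt_ceil_one_div_sq_iff {s : ℝ} (hs : 0 < s) (m : ℕ) :
    ((m : ℤ) + 1 < ⌈1 / s ^ 2⌉) ↔ s < 1 / Real.sqrt ((m : ℝ) + 1) := by
  have hm : (0 : ℝ) < (m : ℝ) + 1 := by positivity
  rw [Int.lt_ceil, lt_div_iff₀ (Real.sqrt_pos.2 hm), lt_div_iff₀ (by positivity)]
  push_cast
  rw [← Real.sqrt_sq hs.le, ← Real.sqrt_mul (by positivity), Real.sqrt_lt' one_pos,
    Real.sqrt_sq hs.le, one_pow, mul_comm]

lemma log_one_add_one_div_eq_sub {α : ℝ} (hα : 0 < α) (m : ℕ) :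
    Real.log (1 + 1 / (1 / α + ((m : ℝ) + 1))) =
      Real.log (1 + α * (((m + 1 : ℕ) : ℝ) + 1)) - Real.log (1 + α * ((m : ℝ) + 1)) := by
  rw [← Real.log_div (by positivity) (by positivity)]
  congr 1
  push_cast
  field_simp
  ring

lemma log_one_add_one_div_nonneg {α : ℝ} (hα : 0 < α) (m : ℕ) :
    0 ≤ Real.log (1 + 1 / (1 / α + ((m : ℝ) + 1))) :=
  Real.log_nonneg (le_add_of_nonneg_right (by positivity))

lemma summable_one_div_sqrt_mul_log {α : ℝ} (hα : 0 < α) :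
    Summable (fun m : ℕ =>
      1 / Real.sqrt ((m : ℝ) + 1) * Real.log (1 + 1 / (1 / α + ((m : ℝ) + 1)))) := by
  have h : Summable (fun m : ℕ => 1 / |(m : ℝ) + 1| ^ (3 / 2 : ℝ)) :=
    (Real.summable_one_div_nat_add_rpow 1 (3 / 2)).2 (by norm_num)
  refine h.of_nonneg_of_le
    (fun m => mul_nonneg (by positivity) (log_one_add_one_div_nonneg hα m)) fun m => ?_
  have hm : (0 : ℝ) < (m : ℝ) + 1 := by positivity
  have hpow : |(m : ℝ) + 1| ^ (3 / 2 : ℝ) = Real.sqrt ((m : ℝ) + 1) * ((m : ℝ) + 1) := by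
    rw [abs_of_pos hm, Real.sqrt_eq_rpow, ← Real.rpow_add_one hm.ne']
    norm_num
  rw [hpow, one_div_mul_eq_div, div_eq_mul_inv _ (Real.sqrt _), ← one_div_mul_one_div,
    mul_comm, ← one_div (Real.sqrt _)]
  gcongr
  calc Real.log (1 + 1 / (1 / α + ((m : ℝ) + 1)))
      ≤ 1 / (1 / α + ((m : ℝ) + 1)) := by
        have := Real.log_le_sub_one_of_pos
          (show 0 < 1 + 1 / (1 / α + ((m : ℝ) + 1)) by positivity)
        linarith
    _ ≤ 1 / ((m : ℝ) + 1) :=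
        one_div_le_one_div_of_le hm (le_add_of_nonneg_left (by positivity))

lemma one_le_ceil_one_div_sq {s : ℝ} (hs : 0 < s) : 1 ≤ ⌈1 / s ^ 2⌉ :=
  Int.one_le_ceil_iff.2 (by positivity)

lemma integrableOn_log_one_add_mul_ceil {α : ℝ} (hα : 0 < α) :
    IntegrableOn (fun s : ℝ => Real.log (1 + α * ((⌈1 / s ^ 2⌉ : ℤ) : ℝ)))
      (Set.Ioc (0 : ℝ) 1) volume := by
  have hlog : IntegrableOn Real.log (Set.Ioc (0 : ℝ) 1) volume :=
    (intervalIntegrable_iff_integrableOn_Ioc_of_le zero_le_one).1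
      intervalIntegral.intervalIntegrable_log'
  have hbound : IntegrableOn (fun s : ℝ => Real.log (1 + 2 * α) - 2 * Real.log s)
      (Set.Ioc (0 : ℝ) 1) volume :=
    (integrableOn_const (by simp)).sub (hlog.const_mul 2)
  refine Integrable.mono' hbound ?_ ?_
  · have h : Measurable (fun s : ℝ => Real.log (1 + α * ((⌈1 / s ^ 2⌉ : ℤ) : ℝ))) := by
      have : Measurable (fun s : ℝ => ((⌈1 / s ^ 2⌉ : ℤ) : ℝ)) :=
        (measurable_from_top (f := fun n : ℤ => (n : ℝ))).comp
          (Int.measurable_ceil.comp (by fun_prop))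
      fun_prop
    exact h.aestronglyMeasurable
  · filter_upwards [ae_restrict_mem measurableSet_Ioc] with s hs
    obtain ⟨h0, h1⟩ := hs
    have hN : (1 : ℝ) ≤ (⌈1 / s ^ 2⌉ : ℤ) := by exact_mod_cast one_le_ceil_one_div_sq h0
    have hN' : ((⌈1 / s ^ 2⌉ : ℤ) : ℝ) < 1 / s ^ 2 + 1 := Int.ceil_lt_add_one _
    have hs2 : (1 : ℝ) ≤ 1 / s ^ 2 := by
      rw [le_div_iff₀ (by positivity), one_mul]
      exact pow_le_one₀ h0.le h1
    rw [Real.norm_of_nonneg (Real.log_nonneg (le_add_of_nonneg_right (by positivity)))]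
    have h2 : 2 * Real.log s = Real.log (s ^ 2) := by simp
    rw [h2, ← Real.log_div (by positivity) (by positivity)]
    refine Real.log_le_log (by positivity) ?_
    calc 1 + α * ((⌈1 / s ^ 2⌉ : ℤ) : ℝ) ≤ 1 / s ^ 2 + α * (2 * (1 / s ^ 2)) := by
          gcongr
          linarith
      _ = (1 + 2 * α) / s ^ 2 := by ring

lemma log_one_add_mul_ceil_eq_tsum {α s : ℝ} (hα : 0 < α) (hs : 0 < s) :
    Real.log (1 + α * ((⌈1 / s ^ 2⌉ : ℤ) : ℝ)) = Real.log (1 + α) +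
      ∑' m : ℕ, (Set.Iio (1 / Real.sqrt ((m : ℝ) + 1))).indicator
        (fun _ => Real.log (1 + 1 / (1 / α + ((m : ℝ) + 1)))) s := by
  obtain ⟨n, hn⟩ := Int.eq_ofNat_of_zero_le (sub_nonneg.2 (one_le_ceil_one_div_sq hs))
  have hceil : ⌈1 / s ^ 2⌉ = (n : ℤ) + 1 := by omega
  have hmem (m : ℕ) : s ∈ Set.Iio (1 / Real.sqrt ((m : ℝ) + 1)) ↔ m ∈ Finset.range n := by
    rw [Set.mem_Iio, ← lt_ceil_one_div_sq_iff hs, hceil, Finset.mem_range]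
    omega
  rw [tsum_eq_sum (s := Finset.range n)
      fun m hm => Set.indicator_of_notMem (mt (hmem m).1 hm) _,
    Finset.sum_congr rfl fun m hm => (Set.indicator_of_mem ((hmem m).2 hm) _).trans
      (log_one_add_one_div_eq_sub hα m),
    Finset.sum_range_sub fun m : ℕ => Real.log (1 + α * ((m : ℝ) + 1)), hceil]
  simp

lemma setIntegral_Ioc_indicator_Iio_const (c : ℝ) {a : ℝ} (h0 : 0 ≤ a) (h1 : a ≤ 1) :
    ∫ s in Set.Ioc (0 : ℝ) 1, (Set.Iio a).indicator (fun _ => c) s = a * c := by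
  have hset : Set.Ioc (0 : ℝ) 1 ∩ Set.Iio a = Set.Ioo 0 a := by
    ext s
    simp only [Set.mem_inter_iff, Set.mem_Ioc, Set.mem_Iio, Set.mem_Ioo]
    exact ⟨fun h => ⟨h.1.1, h.2⟩, fun h => ⟨⟨h.1, h.2.le.trans h1⟩, h.2⟩⟩
  rw [setIntegral_indicator measurableSet_Iio, hset]
  simp [h0]

/-- **Series representation of the ceiling-log integral.** For every `α > 0`, the function
`s ↦ log(1 + α·⌈1/s²⌉)` is integrable on `(0,1]` and
`∫_0^1 log(1 + α·⌈1/s²⌉) ds = log(1+α) + ∑_{m=1}^∞ (1/√m)·log(1 + 1/(1/α + m))`,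
where the series converges. -/
theorem integral_log_ceil_eq_series (α : ℝ) (hα : 0 < α) :
    IntegrableOn (fun s : ℝ => Real.log (1 + α * ((⌈1 / s ^ 2⌉ : ℤ) : ℝ)))
        (Set.Ioc (0 : ℝ) 1) volume ∧
    Summable (fun m : ℕ =>
      1 / Real.sqrt ((m : ℝ) + 1) * Real.log (1 + 1 / (1 / α + ((m : ℝ) + 1)))) ∧
    ∫ s in Set.Ioc (0 : ℝ) 1, Real.log (1 + α * ((⌈1 / s ^ 2⌉ : ℤ) : ℝ)) =
      Real.log (1 + α) +
        ∑' m : ℕ, 1 / Real.sqrt ((m : ℝ) + 1) * Real.log (1 + 1 / (1 / α + ((m : ℝ) + 1))) := by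
  have hint := integrableOn_log_one_add_mul_ceil hα
  have hsum := summable_one_div_sqrt_mul_log hα
  refine ⟨hint, hsum, ?_⟩
  let F : ℕ → ℝ → ℝ := fun m => (Set.Iio (1 / Real.sqrt ((m : ℝ) + 1))).indicator
    (fun _ => Real.log (1 + 1 / (1 / α + ((m : ℝ) + 1))))
  have hF_int (m : ℕ) : Integrable (F m) (volume.restrict (Set.Ioc (0 : ℝ) 1)) :=
    (integrable_const _).indicator measurableSet_Iio
  have hF_integral (m : ℕ) : ∫ s in Set.Ioc (0 : ℝ) 1, F m s =
      1 / Real.sqrt ((m : ℝ) + 1) * Real.log (1 + 1 / (1 / α + ((m : ℝ) + 1))) := by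
    refine setIntegral_Ioc_indicator_Iio_const _ (by positivity) ?_
    rw [div_le_one (by positivity), Real.one_le_sqrt]
    exact le_add_of_nonneg_left m.cast_nonneg
  have hF_norm (m : ℕ) (s : ℝ) : ‖F m s‖ = F m s :=
    Real.norm_of_nonneg (Set.indicator_nonneg (fun _ _ => log_one_add_one_div_nonneg hα m) s)
  have hF := hasSum_integral_of_summable_integral_norm hF_int
    (by simpa only [hF_norm, hF_integral] using hsum)
  simp only [hF_integral] at hF
  have hsub : ∫ s in Set.Ioc (0 : ℝ) 1, (∑' m, F m s) =
      ∫ s in Set.Ioc (0 : ℝ) 1,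
        (Real.log (1 + α * ((⌈1 / s ^ 2⌉ : ℤ) : ℝ)) - Real.log (1 + α)) :=
    setIntegral_congr_fun measurableSet_Ioc fun s hs =>
      eq_sub_of_add_eq' (log_one_add_mul_ceil_eq_tsum hα hs.1).symm
  rw [hF.tsum_eq, hsub, integral_sub hint (integrable_const _)]
  simp
end
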